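/- Let d ≥ 5 and let 0 < p ≤ d - 4. Then for every n ≥ 1 and all real scalars a_1, …, a_n, not all zero, the sum S = a_1 ξ_1 + … + a_n ξ_n of independent random vectors uniform on the unit sphere S^{d-1} satisfies E|S|^{-p} ≤ (d/2)^{p/2} · (Γ((d-p)/2)/Γ(d/2)) · (a_1² + … + a_n²)^{-p/2}. (Equivalently, the sharp Khinchin constant c_d(q) for q = -p equals the Gaussian constant c_{d,∞}(q).) -/

import Mathlib

open MeasureTheory Real Set
open scoped ENNReal

/-- `μ` is the uniform probability measure on the unit sphere `S^{d-1}` in `ℝ^d`: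
it is supported on the unit sphere and invariant under every orthogonal map.
(Such a probability measure is unique, namely the normalized rotation-invariant
measure on the sphere.) -/
def IsUniformOnSphere {d : ℕ} (μ : Measure (EuclideanSpace ℝ (Fin d))) : Prop :=
  μ (Metric.sphere (0 : EuclideanSpace ℝ (Fin d)) 1)ᶜ = 0 ∧
  ∀ Q : EuclideanSpace ℝ (Fin d) ≃ₗᵢ[ℝ] EuclideanSpace ℝ (Fin d), μ.map ⇑Q = μ

lemma nonneg_of_hasDerivAt_nonneg {f f' : ℝ → ℝ} (hf : ∀ r, HasDerivAt f (f' r) r)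
    (h0 : f 0 = 0) (hf' : ∀ r, 0 < r → 0 ≤ f' r) {r : ℝ} (hr : 0 ≤ r) : 0 ≤ f r := by
  have hmono : MonotoneOn f (Ici 0) := by
    refine monotoneOn_of_hasDerivWithinAt_nonneg (f' := f') (convex_Ici 0)
      (fun x _ ↦ (hf x).continuousAt.continuousWithinAt)
      (fun x _ ↦ (hf x).hasDerivWithinAt) fun x hx ↦ hf' x ?_
    simpa using hx
  simpa [h0] using hmono (mem_Ici.2 le_rfl) (mem_Ici.2 hr) hr

/-- If the radial Laplacian `W` of `M` and the radial Laplacian `V` of `W` satisfy `0 ≤ V`, then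
`M` is a convex function of `r ^ 2`, hence has a supporting line at every point. -/
lemma exists_supporting_sq_of_radial_bilaplacian_nonneg {m : ℕ} (hm : 1 ≤ m)
    {M M' M'' W W' W'' V : ℝ → ℝ}
    (hM : ∀ r, HasDerivAt M (M' r) r) (hM' : ∀ r, HasDerivAt M' (M'' r) r)
    (hW : ∀ r, HasDerivAt W (W' r) r) (hW' : ∀ r, HasDerivAt W' (W'' r) r)
    (hMW : ∀ r, r * M'' r + m * M' r = r * W r)
    (hWV : ∀ r, r * W'' r + m * W' r = r * V r) (hV : ∀ r, 0 ≤ V r) {r₀ : ℝ} (hr₀ : 0 < r₀) :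
    ∃ c : ℝ, ∀ r, 0 ≤ r → M r₀ + c * (r ^ 2 - r₀ ^ 2) ≤ M r := by
  obtain ⟨n, rfl⟩ : ∃ n, m = n + 1 := ⟨m - 1, by omega⟩
  push_cast at hMW hWV
  have hpow : ∀ (k : ℕ) (r : ℝ), HasDerivAt (fun r : ℝ ↦ r ^ (k + 1)) ((k + 1) * r ^ k) r := by
    intro k r
    simpa using hasDerivAt_pow (k + 1) r
  have hW'0 : ∀ r, 0 < r → 0 ≤ W' r := by
    intro r hr
    have := nonneg_of_hasDerivAt_nonneg (f := fun r ↦ r ^ (n + 1) * W' r)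
      (fun r ↦ (hpow n r).mul (hW' r)) (by simp) (fun s hs ↦ by
        have : (n + 1) * s ^ n * W' s + s ^ (n + 1) * W'' s = s ^ n * (s * V s) := by
          rw [← hWV s]; ring
        rw [this]
        have := hV s
        positivity) hr.le
    exact nonneg_of_mul_nonneg_right this (by positivity)
  have hle : ∀ r, 0 < r → (n + 2) * M' r ≤ r * W r := by
    intro r hr
    have := nonneg_of_hasDerivAt_nonneg
      (f := fun r ↦ r ^ (n + 2) * W r - (n + 2) * (r ^ (n + 1) * M' r))
      (fun r ↦ ((hpow (n + 1) r).mul (hW r)).sub (((hpow n r).mul (hM' r)).const_mul _)) (by simp)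
      (fun s hs ↦ by
        have : ((n + 1 : ℕ) + 1) * s ^ (n + 1) * W s + s ^ (n + 2) * W' s -
            (n + 2) * ((n + 1) * s ^ n * M' s + s ^ (n + 1) * M'' s) = s ^ (n + 2) * W' s := by
          have h := hMW s
          push_cast
          linear_combination (-(n + 2) * s ^ n) * h
        rw [this]
        have := hW'0 s hs
        positivity) hr.le
    have h2 : 0 ≤ r ^ (n + 1) * (r * W r - (n + 2) * M' r) := by
      calc _ ≤ _ := this
        _ = _ := by ring
    linarith [nonneg_of_mul_nonneg_right h2 (by positivity)]
  have hmono : MonotoneOn (fun r ↦ M' r / r) (Ioi 0) := by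
    refine monotoneOn_of_hasDerivWithinAt_nonneg
      (f' := fun r ↦ (M'' r * r - M' r * 1) / r ^ 2) (convex_Ioi 0)
      (fun x hx ↦ ?_) (fun x hx ↦ ?_) fun x hx ↦ ?_
    · exact ((hM' x).div (hasDerivAt_id x) (ne_of_gt hx)).continuousAt.continuousWithinAt
    · rw [interior_Ioi] at hx
      exact ((hM' x).div (hasDerivAt_id x) (ne_of_gt hx)).hasDerivWithinAt
    · rw [interior_Ioi] at hx
      refine div_nonneg ?_ (sq_nonneg _)
      linarith [hle x hx, hMW x]
  refine ⟨M' r₀ / r₀ / 2, fun r hr ↦ ?_⟩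
  set c := M' r₀ / r₀ with hc
  have hd : ∀ s, HasDerivAt (fun s ↦ M s - c / 2 * (s ^ 2 - r₀ ^ 2)) (M' s - c * s) s := by
    intro s
    refine ((hM s).sub (((hasDerivAt_pow 2 s).sub_const (r₀ ^ 2)).const_mul (c / 2))).congr_deriv ?_
    norm_num
    ring
  have hcont : Continuous (fun s ↦ M s - c / 2 * (s ^ 2 - r₀ ^ 2)) :=
    continuous_iff_continuousAt.2 fun s ↦ (hd s).continuousAt
  have key : M r₀ - c / 2 * (r₀ ^ 2 - r₀ ^ 2) ≤ M r - c / 2 * (r ^ 2 - r₀ ^ 2) := by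
    rcases le_total r r₀ with h | h
    · refine antitoneOn_of_hasDerivWithinAt_nonpos (convex_Icc 0 r₀) hcont.continuousOn
        (fun x _ ↦ (hd x).hasDerivWithinAt) (fun x hx ↦ ?_) ⟨hr, h⟩ ⟨hr₀.le, le_rfl⟩ h
      rw [interior_Icc] at hx
      have := hmono (mem_Ioi.2 hx.1) (mem_Ioi.2 hr₀) hx.2.le
      have := (div_le_iff₀ hx.1).1 this
      linarith
    · refine monotoneOn_of_hasDerivWithinAt_nonneg (convex_Ici r₀) hcont.continuousOn
        (fun x _ ↦ (hd x).hasDerivWithinAt) (fun x hx ↦ ?_) (mem_Ici.2 le_rfl) (mem_Ici.2 h) h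
      rw [interior_Ici] at hx
      have hx0 : 0 < x := hr₀.trans hx
      have := hmono (mem_Ioi.2 hr₀) (mem_Ioi.2 hx0) (le_of_lt hx)
      have := (le_div_iff₀ hx0).1 this
      linarith
  linarith

section Compact

variable {E : Type*} [NormedAddCommGroup E] [MeasurableSpace E] [BorelSpace E]
  {μ : Measure E} [IsFiniteMeasure μ] {K : Set E}

lemma integrable_of_continuous_of_isCompact (hK : IsCompact K) (hμK : μ Kᶜ = 0) {g : E → ℝ}
    (hg : Continuous g) : Integrable g μ := by
  have h := hg.continuousOn.integrableOn_compact (μ := μ) hK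
  rwa [IntegrableOn, Measure.restrict_eq_self_of_ae_mem (by simpa [ae_iff] using! hμK)] at h

lemma hasDerivAt_integral_of_isCompact [SecondCountableTopology E] (hK : IsCompact K)
    (hμK : μ Kᶜ = 0) {G G' : ℝ → E → ℝ}
    (hG : ∀ t, Continuous (G t)) (hG' : Continuous (Function.uncurry G'))
    (hd : ∀ t x, HasDerivAt (G · x) (G' t x) t) (t : ℝ) :
    HasDerivAt (fun t ↦ ∫ x, G t x ∂μ) (∫ x, G' t x ∂μ) t := by
  obtain ⟨C, hC⟩ := ((isCompact_Icc (a := t - 1) (b := t + 1)).prod hK).exists_bound_of_continuousOn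
    hG'.continuousOn
  have hmem : ∀ᵐ x ∂μ, x ∈ K := by simpa [ae_iff] using! hμK
  refine (hasDerivAt_integral_of_dominated_loc_of_deriv_le (bound := fun _ ↦ C)
    (Icc_mem_nhds (by linarith) (by linarith) : Icc (t - 1) (t + 1) ∈ nhds t)
    (.of_forall fun s ↦ (hG s).aestronglyMeasurable)
    (integrable_of_continuous_of_isCompact hK hμK (hG t))
    (hG'.comp (by fun_prop : Continuous fun x : E ↦ (t, x))).aestronglyMeasurable ?_
    (integrable_const C) (.of_forall fun x s _ ↦ hd s x)).2
  filter_upwards [hmem] with x hx s hs using hC (s, x) ⟨hs, hx⟩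

end Compact

section Rotation

variable {d : ℕ} {μ : Measure (EuclideanSpace ℝ (Fin d))}

lemma IsUniformOnSphere.ae_norm_eq_one (hμ : IsUniformOnSphere μ) : ∀ᵐ x ∂μ, ‖x‖ = 1 := by
  simpa [ae_iff, Set.compl_def] using hμ.1

lemma IsUniformOnSphere.integral_comp (hμ : IsUniformOnSphere μ)
    (Q : EuclideanSpace ℝ (Fin d) ≃ₗᵢ[ℝ] EuclideanSpace ℝ (Fin d))
    (g : EuclideanSpace ℝ (Fin d) → ℝ) : ∫ x, g (Q x) ∂μ = ∫ x, g x ∂μ := by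
  conv_rhs => rw [← hμ.2 Q]
  exact (Q.toHomeomorph.measurableEmbedding.integral_map g).symm

variable [IsProbabilityMeasure μ]

lemma IsUniformOnSphere.integrable (hμ : IsUniformOnSphere μ) {g : EuclideanSpace ℝ (Fin d) → ℝ}
    (hg : Continuous g) : Integrable g μ :=
  integrable_of_continuous_of_isCompact (isCompact_sphere _ _) hμ.1 hg

open NormedSpace in
/-- Infinitesimal rotation invariance. -/
lemma IsUniformOnSphere.integral_fderiv_skewAdjoint_eq_zero (hμ : IsUniformOnSphere μ)
    {A : EuclideanSpace ℝ (Fin d) →L[ℝ] EuclideanSpace ℝ (Fin d)}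
    (hA : A ∈ skewAdjoint (EuclideanSpace ℝ (Fin d) →L[ℝ] EuclideanSpace ℝ (Fin d)))
    {F : EuclideanSpace ℝ (Fin d) → ℝ}
    {F' : EuclideanSpace ℝ (Fin d) → EuclideanSpace ℝ (Fin d) →L[ℝ] ℝ}
    (hF : ∀ x, HasFDerivAt F (F' x) x) (hF' : Continuous F') :
    ∫ x, F' x (A x) ∂μ = 0 := by
  have hFc : Continuous F := continuous_iff_continuousAt.2 fun x ↦ (hF x).continuousAt
  let _ : NormedAlgebra ℚ (EuclideanSpace ℝ (Fin d) →L[ℝ] EuclideanSpace ℝ (Fin d)) :=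
    NormedAlgebra.restrictScalars ℚ ℝ _
  obtain ⟨U, hU0, hU, hUu⟩ : ∃ U : ℝ → EuclideanSpace ℝ (Fin d) →L[ℝ] EuclideanSpace ℝ (Fin d),
      U 0 = 1 ∧ (∀ t, HasDerivAt U (U t * A) t) ∧ ∀ t, U t ∈ unitary _ :=
    ⟨fun t ↦ exp (t • A), (congrArg NormedSpace.exp (zero_smul ℝ A)).trans NormedSpace.exp_zero,
      hasDerivAt_exp_smul_const A,
      fun t ↦ exp_mem_unitary_of_mem_skewAdjoint (skewAdjoint.smul_mem t hA)⟩
  have hUc : Continuous U := continuous_iff_continuousAt.2 fun t ↦ (hU t).continuousAt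
  have h1 := hasDerivAt_integral_of_isCompact (isCompact_sphere _ _) hμ.1
    (G := fun t x ↦ F (U t x)) (G' := fun t x ↦ F' (U t x) (U t (A x)))
    (fun t ↦ by fun_prop) (by unfold Function.uncurry; fun_prop)
    (fun t x ↦ (hF _).comp_hasDerivAt t (((hU t).clm_apply (hasDerivAt_const t x)).congr_deriv
      (by simp))) 0
  have h2 : (fun t : ℝ ↦ ∫ x, F (U t x) ∂μ) = fun _ ↦ ∫ x, F x ∂μ := by
    funext t
    exact hμ.integral_comp (Unitary.linearIsometryEquiv ⟨U t, hUu t⟩) F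
  rw [h2] at h1
  simpa [hU0] using h1.unique (hasDerivAt_const 0 _)

/-- The generator of the rotations in the plane of `y` and `v`. -/
noncomputable def planeRotation (y v : EuclideanSpace ℝ (Fin d)) :
    EuclideanSpace ℝ (Fin d) →L[ℝ] EuclideanSpace ℝ (Fin d) :=
  (innerSL ℝ y).smulRight v - (innerSL ℝ v).smulRight y

lemma planeRotation_apply (y v x : EuclideanSpace ℝ (Fin d)) :
    planeRotation y v x = inner ℝ y x • v - inner ℝ v x • y := by
  simp [planeRotation]

lemma planeRotation_mem_skewAdjoint (y v : EuclideanSpace ℝ (Fin d)) :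
    planeRotation y v ∈
      skewAdjoint (EuclideanSpace ℝ (Fin d) →L[ℝ] EuclideanSpace ℝ (Fin d)) := by
  rw [skewAdjoint.mem_iff, ContinuousLinearMap.star_eq_adjoint]
  symm
  rw [ContinuousLinearMap.eq_adjoint_iff]
  intro a b
  simp only [_root_.neg_apply, planeRotation_apply, inner_neg_left, inner_sub_left,
    inner_sub_right, real_inner_smul_right, real_inner_comm]
  rw [real_inner_comm b y, real_inner_comm b v]
  ring

end Rotation

section Radial

variable {d : ℕ} {μ : Measure (EuclideanSpace ℝ (Fin d))} {ε : ℝ}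

/-- The spherical mean of radius `r` around `y` of the smoothed power `(ε + ‖·‖ ^ 2) ^ (-k)`. -/
noncomputable def smoothedMean (μ : Measure (EuclideanSpace ℝ (Fin d))) (ε : ℝ)
    (y : EuclideanSpace ℝ (Fin d)) (k r : ℝ) : ℝ :=
  ∫ x, (ε + ‖y + r • x‖ ^ 2) ^ (-k) ∂μ

lemma smoothedMean_nonneg (hε : 0 < ε) (y : EuclideanSpace ℝ (Fin d)) (k r : ℝ) :
    0 ≤ smoothedMean μ ε y k r :=
  integral_nonneg fun x ↦ by positivity

lemma continuous_smoothed_rpow (hε : 0 < ε) (y : EuclideanSpace ℝ (Fin d)) (k r : ℝ) :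
    Continuous fun x : EuclideanSpace ℝ (Fin d) ↦ (ε + ‖y + r • x‖ ^ 2) ^ k :=
  Continuous.rpow_const (by fun_prop) fun x ↦ Or.inl (by positivity)

lemma continuous_smoothed_rpow_prod (hε : 0 < ε) (y : EuclideanSpace ℝ (Fin d)) (k : ℝ) :
    Continuous fun q : ℝ × EuclideanSpace ℝ (Fin d) ↦ (ε + ‖y + q.1 • q.2‖ ^ 2) ^ k :=
  Continuous.rpow_const (by fun_prop) fun x ↦ Or.inl (by positivity)

lemma hasDerivAt_smoothed (y x : EuclideanSpace ℝ (Fin d)) (r : ℝ) :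
    HasDerivAt (fun r : ℝ ↦ ε + ‖y + r • x‖ ^ 2) (2 * (inner ℝ y x + r * ‖x‖ ^ 2)) r := by
  have h : HasDerivAt (fun r : ℝ ↦ y + r • x) x r := by
    simpa using ((hasDerivAt_id r).smul_const x).const_add y
  refine (h.norm_sq.const_add ε).congr_deriv ?_
  rw [inner_add_left, real_inner_smul_left, real_inner_self_eq_norm_sq]

lemma hasDerivAt_smoothed_rpow (hε : 0 < ε) (y x : EuclideanSpace ℝ (Fin d)) (k r : ℝ) :
    HasDerivAt (fun r : ℝ ↦ (ε + ‖y + r • x‖ ^ 2) ^ (-k))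
      (-2 * k * ((inner ℝ y x + r * ‖x‖ ^ 2) * (ε + ‖y + r • x‖ ^ 2) ^ (-(k + 1)))) r := by
  convert (hasDerivAt_smoothed (ε := ε) y x r).rpow_const (p := -k)
    (Or.inl (by positivity)) using 1
  rw [show -(k + 1) = -k - 1 by ring]
  ring

variable [IsProbabilityMeasure μ]

/-- The first radial derivative of `smoothedMean`. -/
noncomputable def smoothedMeanDeriv (μ : Measure (EuclideanSpace ℝ (Fin d))) (ε : ℝ)
    (y : EuclideanSpace ℝ (Fin d)) (k r : ℝ) : ℝ :=
  ∫ x, -2 * k * ((inner ℝ y x + r * ‖x‖ ^ 2) * (ε + ‖y + r • x‖ ^ 2) ^ (-(k + 1))) ∂μ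

/-- The second radial derivative of `smoothedMean`. -/
noncomputable def smoothedMeanDeriv2 (μ : Measure (EuclideanSpace ℝ (Fin d))) (ε : ℝ)
    (y : EuclideanSpace ℝ (Fin d)) (k r : ℝ) : ℝ :=
  ∫ x, -2 * k * (‖x‖ ^ 2 * (ε + ‖y + r • x‖ ^ 2) ^ (-(k + 1)) + (inner ℝ y x + r * ‖x‖ ^ 2) *
    (-2 * (k + 1) * ((inner ℝ y x + r * ‖x‖ ^ 2) * (ε + ‖y + r • x‖ ^ 2) ^ (-(k + 1 + 1))))) ∂μ

lemma IsUniformOnSphere.hasDerivAt_smoothedMean (hμ : IsUniformOnSphere μ) (hε : 0 < ε)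
    (y : EuclideanSpace ℝ (Fin d)) (k r : ℝ) :
    HasDerivAt (smoothedMean μ ε y k) (smoothedMeanDeriv μ ε y k r) r := by
  have h1 := continuous_smoothed_rpow_prod hε y (-(k + 1))
  exact hasDerivAt_integral_of_isCompact (isCompact_sphere _ _) hμ.1
    (G := fun r x ↦ (ε + ‖y + r • x‖ ^ 2) ^ (-k))
    (G' := fun r x ↦
      -2 * k * ((inner ℝ y x + r * ‖x‖ ^ 2) * (ε + ‖y + r • x‖ ^ 2) ^ (-(k + 1))))
    (fun t ↦ continuous_smoothed_rpow hε y _ t) (by unfold Function.uncurry; fun_prop)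
    (fun t x ↦ hasDerivAt_smoothed_rpow hε y x k t) r

lemma IsUniformOnSphere.hasDerivAt_smoothedMeanDeriv (hμ : IsUniformOnSphere μ) (hε : 0 < ε)
    (y : EuclideanSpace ℝ (Fin d)) (k r : ℝ) :
    HasDerivAt (smoothedMeanDeriv μ ε y k) (smoothedMeanDeriv2 μ ε y k r) r := by
  have h1 := continuous_smoothed_rpow_prod hε y (-(k + 1))
  have h2 := continuous_smoothed_rpow_prod hε y (-(k + 1 + 1))
  refine hasDerivAt_integral_of_isCompact (isCompact_sphere _ _) hμ.1
    (G := fun r x ↦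
      -2 * k * ((inner ℝ y x + r * ‖x‖ ^ 2) * (ε + ‖y + r • x‖ ^ 2) ^ (-(k + 1))))
    (G' := fun r x ↦ -2 * k * (‖x‖ ^ 2 * (ε + ‖y + r • x‖ ^ 2) ^ (-(k + 1)) +
      (inner ℝ y x + r * ‖x‖ ^ 2) * (-2 * (k + 1) *
        ((inner ℝ y x + r * ‖x‖ ^ 2) * (ε + ‖y + r • x‖ ^ 2) ^ (-(k + 1 + 1)))))) (fun t ↦ ?_)
    (by unfold Function.uncurry; fun_prop) (fun t x ↦ ?_) r
  · have := continuous_smoothed_rpow hε y (-(k + 1)) t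
    fun_prop
  · have h : HasDerivAt (fun r : ℝ ↦ inner ℝ y x + r * ‖x‖ ^ 2) (‖x‖ ^ 2) t := by
      simpa using ((hasDerivAt_id t).mul_const (‖x‖ ^ 2)).const_add (inner ℝ y x)
    exact (h.mul (hasDerivAt_smoothed_rpow hε y x (k + 1) t)).const_mul _

/-- Integration by parts along the rotations moving the direction of `y`. -/
lemma IsUniformOnSphere.integral_inner_mul_smoothed (hμ : IsUniformOnSphere μ) (hε : 0 < ε)
    (y : EuclideanSpace ℝ (Fin d)) (k r : ℝ) :
    (d - 1) * ∫ x, inner ℝ y x * (ε + ‖y + r • x‖ ^ 2) ^ (-k) ∂μ =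
      -2 * k * r * ∫ x, (‖y‖ ^ 2 - inner ℝ y x ^ 2) * (ε + ‖y + r • x‖ ^ 2) ^ (-(k + 1)) ∂μ := by
  have hD : ∀ x : EuclideanSpace ℝ (Fin d),
      HasFDerivAt (fun x : EuclideanSpace ℝ (Fin d) ↦ ε + ‖y + r • x‖ ^ 2)
        ((2 * r) • innerSL ℝ (y + r • x)) x := by
    intro x
    have h : HasFDerivAt (fun x : EuclideanSpace ℝ (Fin d) ↦ y + r • x)
        (r • ContinuousLinearMap.id ℝ (EuclideanSpace ℝ (Fin d))) x :=
      ((hasFDerivAt_id x).const_smul r).const_add y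
    convert! h.norm_sq.const_add ε using 1
    ext v
    simp
    ring
  have hc1 := continuous_smoothed_rpow hε y (-k) r
  have hc2 := continuous_smoothed_rpow hε y (-k - 1) r
  have hv : ∀ v : EuclideanSpace ℝ (Fin d), ∫ x, ((ε + ‖y + r • x‖ ^ 2) ^ (-k) *
      (inner ℝ y x * ‖v‖ ^ 2 - inner ℝ v x * inner ℝ v y) + inner ℝ v x * (-k *
      (ε + ‖y + r • x‖ ^ 2) ^ (-k - 1) * (2 * r * (inner ℝ y x * inner ℝ v y -
        inner ℝ v x * ‖y‖ ^ 2)))) ∂μ = 0 := by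
    intro v
    rw [← hμ.integral_fderiv_skewAdjoint_eq_zero (planeRotation_mem_skewAdjoint y v)
      (fun x ↦ ((hD x).rpow_const (p := -k) (Or.inl (by positivity))).mul
        (innerSL ℝ v).hasFDerivAt) (by fun_prop)]
    refine integral_congr_ae (.of_forall fun x ↦ ?_)
    simp only [planeRotation_apply, innerSL_apply_apply, _root_.add_apply,
      _root_.smul_apply, inner_sub_right, inner_add_left, real_inner_smul_left,
      real_inner_smul_right, real_inner_self_eq_norm_sq, smul_eq_mul, real_inner_comm v,
      real_inner_comm y x]
    ring
  have hint : ∀ v : EuclideanSpace ℝ (Fin d), Integrable (fun x ↦ (ε + ‖y + r • x‖ ^ 2) ^ (-k) *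
      (inner ℝ y x * ‖v‖ ^ 2 - inner ℝ v x * inner ℝ v y) + inner ℝ v x * (-k *
      (ε + ‖y + r • x‖ ^ 2) ^ (-k - 1) * (2 * r * (inner ℝ y x * inner ℝ v y -
        inner ℝ v x * ‖y‖ ^ 2)))) μ := fun v ↦ hμ.integrable (by fun_prop)
  have hsum := integral_finsetSum (μ := μ) Finset.univ
    fun i _ ↦ hint (EuclideanSpace.basisFun (Fin d) ℝ i)
  rw [Finset.sum_eq_zero fun i _ ↦ hv _] at hsum
  rw [← integral_const_mul, ← integral_const_mul, ← sub_eq_zero, ← integral_sub, ← hsum]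
  · refine integral_congr_ae ?_
    filter_upwards [hμ.ae_norm_eq_one] with x hx
    set b := EuclideanSpace.basisFun (Fin d) ℝ
    have h1 : ∑ i, inner ℝ (b i) x * inner ℝ (b i) y = inner ℝ y x := by
      rw [← b.sum_inner_mul_inner y x]
      exact Finset.sum_congr rfl fun i _ ↦ by rw [real_inner_comm y, mul_comm]
    have h2 : ∑ i, inner ℝ (b i) x * inner ℝ (b i) x = 1 := by
      have := b.sum_inner_mul_inner x x
      rw [real_inner_self_eq_norm_sq, hx] at this
      simpa [real_inner_comm] using this
    have h3 : ∀ i, ‖b i‖ = 1 := b.norm_eq_one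
    set D := ε + ‖y + r • x‖ ^ 2
    rw [show -(k + 1) = -k - 1 by ring]
    have h4 : ∀ i, D ^ (-k) * (inner ℝ y x * ‖b i‖ ^ 2 - inner ℝ (b i) x * inner ℝ (b i) y) +
        inner ℝ (b i) x * (-k * D ^ (-k - 1) * (2 * r * (inner ℝ y x * inner ℝ (b i) y -
        inner ℝ (b i) x * ‖y‖ ^ 2))) = D ^ (-k) * inner ℝ y x -
        (D ^ (-k) + 2 * k * r * D ^ (-k - 1) * inner ℝ y x) *
          (inner ℝ (b i) x * inner ℝ (b i) y) +
        2 * k * r * D ^ (-k - 1) * ‖y‖ ^ 2 * (inner ℝ (b i) x * inner ℝ (b i) x) := by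
      intro i
      rw [h3]
      ring
    simp_rw [h4]
    rw [Finset.sum_add_distrib, Finset.sum_sub_distrib,
      ← Finset.mul_sum, ← Finset.mul_sum, ← Finset.mul_sum, h1, h2]
    simp only [Finset.sum_const, Finset.card_univ, Fintype.card_fin, nsmul_eq_mul]
    ring
  · exact hμ.integrable (by fun_prop)
  · have := continuous_smoothed_rpow hε y (-(k + 1)) r
    exact hμ.integrable (by fun_prop)

/-- The Darboux equation for the spherical means of `(ε + ‖·‖ ^ 2) ^ (-k)`. -/
lemma IsUniformOnSphere.darboux_smoothedMean (hμ : IsUniformOnSphere μ) (hε : 0 < ε)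
    (y : EuclideanSpace ℝ (Fin d)) (k r : ℝ) :
    r * smoothedMeanDeriv2 μ ε y k r + (d - 1) * smoothedMeanDeriv μ ε y k r =
      r * ((4 * k * (k + 1) - 2 * k * d) * smoothedMean μ ε y (k + 1) r -
        4 * k * (k + 1) * ε * smoothedMean μ ε y (k + 2) r) := by
  have hparts := hμ.integral_inner_mul_smoothed hε y (k + 1) r
  have hc1 := continuous_smoothed_rpow hε y (-(k + 1)) r
  have hc2 := continuous_smoothed_rpow hε y (-(k + 1 + 1)) r
  have hc3 := continuous_smoothed_rpow hε y (-(k + 2)) r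
  have hD1 : smoothedMeanDeriv μ ε y k r = -2 * k *
      (∫ x, inner ℝ y x * (ε + ‖y + r • x‖ ^ 2) ^ (-(k + 1)) ∂μ +
        r * smoothedMean μ ε y (k + 1) r) := by
    rw [smoothedMeanDeriv, integral_const_mul, smoothedMean, ← integral_const_mul r,
      ← integral_add]
    · congr 1
      refine integral_congr_ae ?_
      filter_upwards [hμ.ae_norm_eq_one] with x hx
      rw [hx]
      ring
    all_goals exact hμ.integrable (by fun_prop)
  rw [hD1]
  have hD2 : r * smoothedMeanDeriv2 μ ε y k r - 2 * k *
      (-2 * (k + 1) * r * ∫ x, (‖y‖ ^ 2 - inner ℝ y x ^ 2) *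
        (ε + ‖y + r • x‖ ^ 2) ^ (-(k + 1 + 1)) ∂μ) =
      r * ((4 * k * (k + 1) - 2 * k) * smoothedMean μ ε y (k + 1) r -
        4 * k * (k + 1) * ε * smoothedMean μ ε y (k + 2) r) := by
    simp only [smoothedMeanDeriv2, smoothedMean, ← integral_const_mul]
    rw [← integral_sub, ← integral_sub, ← integral_const_mul]
    · refine integral_congr_ae ?_
      filter_upwards [hμ.ae_norm_eq_one] with x hx
      rw [hx]
      have hDx : ε + ‖y + r • x‖ ^ 2 = ε + ‖y‖ ^ 2 + 2 * r * inner ℝ y x + r ^ 2 := by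
        rw [norm_add_sq_real, real_inner_smul_right, norm_smul, hx, mul_one, norm_eq_abs, sq_abs]
        ring
      have hpos : 0 < ε + ‖y + r • x‖ ^ 2 := by positivity
      have hpow : (ε + ‖y + r • x‖ ^ 2) ^ (-(k + 1)) =
          (ε + ‖y + r • x‖ ^ 2) * (ε + ‖y + r • x‖ ^ 2) ^ (-(k + 2)) := by
        rw [show -(k + 1) = 1 + -(k + 2) by ring, rpow_add hpos, rpow_one]
      rw [show k + 1 + 1 = k + 2 by ring, hpow]
      generalize (ε + ‖y + r • x‖ ^ 2) ^ (-(k + 2)) = P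
      rw [hDx]
      ring
    all_goals exact hμ.integrable (by fun_prop)
  linear_combination hD2 - 2 * k * hparts

/-- For `2 * k ≤ d - 4` the function `(ε + ‖·‖ ^ 2) ^ (-k)` is bi-subharmonic, so that its
spherical means are convex functions of the squared radius. -/
lemma IsUniformOnSphere.exists_supporting_sq_smoothedMean (hμ : IsUniformOnSphere μ) (hε : 0 < ε)
    (hd : 2 ≤ d) (y : EuclideanSpace ℝ (Fin d)) {k : ℝ} (hk : 0 < k) (hkd : 2 * k ≤ d - 4)
    {r₀ : ℝ} (hr₀ : 0 < r₀) :
    ∃ c : ℝ, ∀ r, 0 ≤ r →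
      smoothedMean μ ε y k r₀ + c * (r ^ 2 - r₀ ^ 2) ≤ smoothedMean μ ε y k r := by
  have hW : ∀ j r, HasDerivAt (smoothedMean μ ε y j) (smoothedMeanDeriv μ ε y j r) r :=
    fun j r ↦ hμ.hasDerivAt_smoothedMean hε y j r
  have hW' : ∀ j r, HasDerivAt (smoothedMeanDeriv μ ε y j) (smoothedMeanDeriv2 μ ε y j r) r :=
    fun j r ↦ hμ.hasDerivAt_smoothedMeanDeriv hε y j r
  set A := 4 * k * (k + 1) - 2 * k * d
  set B := 4 * k * (k + 1) * ε
  have hcast : ((d - 1 : ℕ) : ℝ) = d - 1 := by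
    rw [Nat.cast_sub (by omega)]
    simp
  refine exists_supporting_sq_of_radial_bilaplacian_nonneg (m := d - 1) (by omega)
    (fun r ↦ hW k r) (fun r ↦ hW' k r)
    (fun r ↦ ((hW (k + 1) r).const_mul A).sub ((hW (k + 2) r).const_mul B))
    (fun r ↦ ((hW' (k + 1) r).const_mul A).sub ((hW' (k + 2) r).const_mul B))
    (V := fun r ↦ 8 * k * (k + 1) * (d - 2 - 2 * k) * (d - 4 - 2 * k) / 2 *
        smoothedMean μ ε y (k + 2) r +
      16 * k * (k + 1) * (k + 2) * ε * (d - 4 - 2 * k) * smoothedMean μ ε y (k + 3) r +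
      16 * k * (k + 1) * (k + 2) * (k + 3) * ε ^ 2 * smoothedMean μ ε y (k + 4) r)
    (fun r ↦ ?_) (fun r ↦ ?_) (fun r ↦ ?_) hr₀
  · rw [hcast]
    exact hμ.darboux_smoothedMean hε y k r
  · rw [hcast]
    have h1 := hμ.darboux_smoothedMean hε y (k + 1) r
    have h2 := hμ.darboux_smoothedMean hε y (k + 2) r
    rw [show k + 1 + 1 = k + 2 by ring, show k + 1 + 2 = k + 3 by ring] at h1
    rw [show k + 2 + 1 = k + 3 by ring, show k + 2 + 2 = k + 4 by ring] at h2
    simp only [A, B]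
    linear_combination (4 * k * (k + 1) - 2 * k * d) * h1 - (4 * k * (k + 1) * ε) * h2
  · have h2 := smoothedMean_nonneg (μ := μ) hε y (k + 2) r
    have h3 := smoothedMean_nonneg (μ := μ) hε y (k + 3) r
    have h4 := smoothedMean_nonneg (μ := μ) hε y (k + 4) r
    have h5 : 0 ≤ d - 4 - 2 * k := by linarith
    have h6 : 0 ≤ d - 2 - 2 * k := by linarith
    positivity

end Radial

section Gaussian

open ProbabilityTheory

variable {d : ℕ}

lemma stdGaussian_eq_withDensity :
    stdGaussian (EuclideanSpace ℝ (Fin d)) = volume.withDensity fun x ↦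
      ENNReal.ofReal ((2 * π) ^ (-(d : ℝ) / 2) * exp (-(1 / 2) * ‖x‖ ^ 2)) := by
  have hint : Integrable (fun x : EuclideanSpace ℝ (Fin d) ↦
      (2 * π) ^ (-(d : ℝ) / 2) * exp (-(1 / 2) * ‖x‖ ^ 2)) := by
    refine Integrable.const_mul ?_ _
    refine (GaussianFourier.integrable_cexp_neg_mul_sq_norm_add (b := 1 / 2) (by norm_num) 0
      (0 : EuclideanSpace ℝ (Fin d))).norm.congr (.of_forall fun x ↦ ?_)
    have h : -(1 / 2 : ℂ) * ‖x‖ ^ 2 + 0 * inner ℝ (0 : EuclideanSpace ℝ (Fin d)) x =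
        (-(1 / 2) * ‖x‖ ^ 2 : ℝ) := by
      push_cast
      ring
    simp only [h, Complex.norm_exp, Complex.ofReal_re]
  have := isFiniteMeasure_withDensity_ofReal hint.2
  refine Measure.ext_of_charFun ?_
  ext t
  rw [charFun_stdGaussian, charFun_apply, integral_withDensity_eq_integral_toReal_smul
    (by fun_prop) (by simp)]
  have hpi : ((2 * π : ℝ) : ℂ) ≠ 0 := by
    exact_mod_cast (by positivity : (2 * π : ℝ) ≠ 0)
  have h := GaussianFourier.integral_cexp_neg_mul_sq_norm_add (b := 1 / 2) (by norm_num) Complex.I t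
  have hcast : (((2 * π) ^ (-(d : ℝ) / 2) : ℝ) : ℂ) = ((2 * π : ℝ) : ℂ) ^ (-(d : ℂ) / 2) := by
    rw [Complex.ofReal_cpow (by positivity)]
    push_cast
    rfl
  calc Complex.exp (-‖t‖ ^ 2 / 2)
      = ((2 * π : ℝ) : ℂ) ^ (-(d : ℂ) / 2) * ((π / (1 / 2)) ^ (d / 2 : ℂ) *
          Complex.exp (Complex.I ^ 2 * ‖t‖ ^ 2 / (4 * (1 / 2)))) := by
        rw [← mul_assoc, show (π / (1 / 2) : ℂ) = ((2 * π : ℝ) : ℂ) by push_cast; ring,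
          ← Complex.cpow_add _ _ hpi]
        rw [show -(d : ℂ) / 2 + d / 2 = 0 by ring, Complex.cpow_zero, Complex.I_sq]
        ring_nf
    _ = _ := by
        rw [finrank_euclideanSpace_fin] at h
        rw [← h, ← hcast, ← integral_const_mul]
        refine integral_congr_ae (.of_forall fun x ↦ ?_)
        simp only []
        rw [ENNReal.toReal_ofReal (by positivity), Complex.exp_add, Complex.real_smul,
          Complex.ofReal_mul, real_inner_comm, Complex.ofReal_exp, mul_assoc,
          mul_comm Complex.I]
        congr 3
        push_cast
        rfl

lemma lintegral_norm_rpow_stdGaussian (hd : 0 < d) {q : ℝ} (hq : -d < q) :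
    ∫⁻ g, ENNReal.ofReal (‖g‖ ^ q) ∂stdGaussian (EuclideanSpace ℝ (Fin d)) =
      ENNReal.ofReal (2 ^ (q / 2) * (Gamma ((d + q) / 2) / Gamma (d / 2))) := by
  have : Nonempty (Fin d) := ⟨⟨0, hd⟩⟩
  obtain ⟨C, hC0, hC⟩ : ∃ C : ℝ, 0 ≤ C ∧ ∀ q : ℝ, -d < q →
      ∫⁻ g, ENNReal.ofReal (‖g‖ ^ q) ∂stdGaussian (EuclideanSpace ℝ (Fin d)) =
        ENNReal.ofReal (C * (2 ^ (q / 2) * Gamma ((d + q) / 2))) := by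
    refine ⟨(d * volume.real (Metric.ball (0 : EuclideanSpace ℝ (Fin d)) 1)) *
      ((2 * π) ^ (-(d : ℝ) / 2) * (2 ^ ((d : ℝ) / 2) * (1 / 2))), by positivity,
      fun q hq ↦ ?_⟩
    set c : ℝ := (2 * π) ^ (-(d : ℝ) / 2)
    have hcongr : ∀ r ∈ Ioi (0 : ℝ), r ^ (d - 1) • (c * exp (-(1 / 2) * r ^ 2) * r ^ q) =
        c * (r ^ (d - 1 + q) * exp (-(1 / 2) * r ^ 2)) := by
      intro r hr
      rw [rpow_add hr, ← Nat.cast_pred hd, rpow_natCast, smul_eq_mul]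
      ring
    have hint : Integrable fun x : EuclideanSpace ℝ (Fin d) ↦
        c * exp (-(1 / 2) * ‖x‖ ^ 2) * ‖x‖ ^ q := by
      rw [integrable_fun_norm_addHaar (μ := volume) (E := EuclideanSpace ℝ (Fin d))
        (f := fun r ↦ c * exp (-(1 / 2) * r ^ 2) * r ^ q), finrank_euclideanSpace_fin]
      have h : IntegrableOn (fun r : ℝ ↦ c * (r ^ (d - 1 + q) * exp (-(1 / 2) * r ^ 2)))
          (Ioi 0) := (integrableOn_rpow_mul_exp_neg_mul_sq (b := 1 / 2) (by norm_num)
        (s := d - 1 + q) (by linarith)).const_mul c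
      exact h.congr_fun (fun r hr ↦ (hcongr r hr).symm) measurableSet_Ioi
    rw [stdGaussian_eq_withDensity, lintegral_withDensity_eq_lintegral_mul _ (by fun_prop)
      (by fun_prop)]
    have hmul : ∀ x : EuclideanSpace ℝ (Fin d), ((fun x : EuclideanSpace ℝ (Fin d) ↦
        ENNReal.ofReal (c * exp (-(1 / 2) * ‖x‖ ^ 2))) * fun x ↦ ENNReal.ofReal (‖x‖ ^ q) :
        EuclideanSpace ℝ (Fin d) → ℝ≥0∞) x =
        ENNReal.ofReal (c * exp (-(1 / 2) * ‖x‖ ^ 2) * ‖x‖ ^ q) := by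
      intro x
      rw [Pi.mul_apply, ← ENNReal.ofReal_mul (by positivity)]
    rw [lintegral_congr hmul, ← ofReal_integral_eq_lintegral_ofReal hint
      (.of_forall fun x ↦ by positivity)]
    rw [integral_fun_norm_addHaar (E := EuclideanSpace ℝ (Fin d)) volume
      (fun r ↦ c * exp (-(1 / 2) * r ^ 2) * r ^ q), finrank_euclideanSpace_fin,
      setIntegral_congr_fun measurableSet_Ioi hcongr, integral_const_mul]
    have hJ := integral_rpow_mul_exp_neg_mul_rpow (p := 2) (q := d - 1 + q) (b := 1 / 2)
      (by norm_num) (by linarith) (by norm_num)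
    simp only [rpow_two] at hJ
    rw [hJ, show (d - 1 + q + 1) / 2 = (d + q) / 2 by ring,
      show -((d : ℝ) - 1 + q + 1) / 2 = -((d : ℝ) / 2 + q / 2) by ring, one_div,
      inv_rpow (by norm_num), ← rpow_neg (by norm_num), neg_neg, rpow_add (by norm_num)]
    congr 1
    simp only [nsmul_eq_mul, smul_eq_mul]
    ring
  have h0 := hC 0 (by simpa using hd)
  have hΓ : 0 < Gamma ((d : ℝ) / 2) := Gamma_pos_of_pos (by positivity)
  have hC1 : C * Gamma (d / 2) = 1 := by
    simp only [rpow_zero, ENNReal.ofReal_one, lintegral_const, measure_univ, mul_one, zero_div,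
      one_mul, add_zero] at h0
    have := congrArg ENNReal.toReal h0
    rw [ENNReal.toReal_ofReal (by positivity)] at this
    simpa using this.symm
  rw [hC q hq, eq_div_of_mul_eq hΓ.ne' hC1]
  congr 1
  ring

lemma integrable_norm_sq_stdGaussian :
    Integrable (fun g ↦ ‖g‖ ^ 2) (stdGaussian (EuclideanSpace ℝ (Fin d))) :=
  (IsGaussian.memLp_two_id (μ := stdGaussian (EuclideanSpace ℝ (Fin d)))).integrable_norm_pow
    (by norm_num)

lemma integral_norm_sq_stdGaussian (hd : 0 < d) :
    ∫ g, ‖g‖ ^ 2 ∂stdGaussian (EuclideanSpace ℝ (Fin d)) = d := by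
  have hd' : (0 : ℝ) < d := by exact_mod_cast hd
  have h := lintegral_norm_rpow_stdGaussian hd (q := 2) (by linarith)
  simp only [rpow_two] at h
  rw [integral_eq_lintegral_of_nonneg_ae (.of_forall fun x ↦ by positivity) (by fun_prop), h,
    show ((d : ℝ) + 2) / 2 = d / 2 + 1 by ring, Gamma_add_one (by positivity),
    mul_div_cancel_right₀ _ (Gamma_pos_of_pos (by positivity)).ne', div_self two_ne_zero,
    rpow_one, ENNReal.toReal_ofReal (by positivity)]
  ring

variable {μ : Measure (EuclideanSpace ℝ (Fin d))}

lemma IsUniformOnSphere.charFun_eq_of_norm_eq (hμ : IsUniformOnSphere μ)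
    {s t : EuclideanSpace ℝ (Fin d)} (h : ‖s‖ = ‖t‖) : charFun μ s = charFun μ t := by
  set Q := (Submodule.span ℝ {t - s})ᗮ.reflection
  have hQ : Q t = s := Submodule.reflection_sub h.symm
  conv_lhs => rw [← hμ.2 Q]
  rw [charFun_apply, charFun_apply, integral_map (by fun_prop) (by fun_prop)]
  refine integral_congr_ae (.of_forall fun x ↦ ?_)
  simp only [← hQ, LinearIsometryEquiv.inner_map_map]

variable [IsProbabilityMeasure μ]

/-- The Gaussian vector has uniform direction, independent of its norm. -/
lemma IsUniformOnSphere.map_norm_smul_stdGaussian (hμ : IsUniformOnSphere μ) :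
    ((stdGaussian (EuclideanSpace ℝ (Fin d))).prod μ).map (fun q ↦ ‖q.1‖ • q.2) =
      stdGaussian (EuclideanSpace ℝ (Fin d)) := by
  have : IsProbabilityMeasure
      (((stdGaussian (EuclideanSpace ℝ (Fin d))).prod μ).map (fun q ↦ ‖q.1‖ • q.2)) :=
    Measure.isProbabilityMeasure_map (by fun_prop)
  refine Measure.ext_of_charFun ?_
  ext t
  have hbound : ∀ x y : EuclideanSpace ℝ (Fin d),
      ‖Complex.exp ((inner ℝ x y : ℝ) * Complex.I)‖ = 1 :=
    fun x y ↦ Complex.norm_exp_ofReal_mul_I _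
  have hint : ∀ f : EuclideanSpace ℝ (Fin d) × EuclideanSpace ℝ (Fin d) → ℝ, Continuous f →
      Integrable (fun q ↦ Complex.exp (f q * Complex.I))
        ((stdGaussian (EuclideanSpace ℝ (Fin d))).prod μ) := by
    intro f hf
    refine Integrable.of_bound (C := 1) (Continuous.aestronglyMeasurable (by fun_prop))
      (.of_forall fun q ↦ (Complex.norm_exp_ofReal_mul_I _).le)
  rw [charFun_apply, integral_map (by fun_prop) (by fun_prop), integral_prod _
    (hint (fun q ↦ inner ℝ (‖q.1‖ • q.2) t) (by fun_prop))]
  calc ∫ g, ∫ x, Complex.exp ((inner ℝ (‖g‖ • x) t : ℝ) * Complex.I) ∂μ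
        ∂stdGaussian (EuclideanSpace ℝ (Fin d))
      = ∫ g, charFun μ (‖g‖ • t) ∂stdGaussian (EuclideanSpace ℝ (Fin d)) := by
        simp only [charFun_apply, real_inner_smul_left, real_inner_smul_right]
    _ = ∫ g, charFun μ (‖t‖ • g) ∂stdGaussian (EuclideanSpace ℝ (Fin d)) := by
        refine integral_congr_ae (.of_forall fun g ↦ hμ.charFun_eq_of_norm_eq ?_)
        simp [norm_smul, mul_comm]
    _ = ∫ x, charFun (stdGaussian (EuclideanSpace ℝ (Fin d))) (‖t‖ • x) ∂μ := by
        simp only [charFun_apply]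
        rw [integral_integral_swap (hint (fun q ↦ inner ℝ q.2 (‖t‖ • q.1)) (by fun_prop))]
        simp only [real_inner_smul_right, real_inner_comm]
    _ = ∫ x, charFun (stdGaussian (EuclideanSpace ℝ (Fin d))) t ∂μ := by
        refine integral_congr_ae ?_
        filter_upwards [hμ.ae_norm_eq_one] with x hx
        simp [charFun_stdGaussian, norm_smul, hx]
    _ = _ := by simp

lemma lintegral_lintegral_add_smul_stdGaussian (a b : ℝ)
    {f : EuclideanSpace ℝ (Fin d) → ℝ≥0∞} (hf : Measurable f) :
    ∫⁻ g, ∫⁻ h, f (a • g + b • h) ∂stdGaussian (EuclideanSpace ℝ (Fin d))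
        ∂stdGaussian (EuclideanSpace ℝ (Fin d)) =
      ∫⁻ g, f (√(a ^ 2 + b ^ 2) • g) ∂stdGaussian (EuclideanSpace ℝ (Fin d)) := by
  set γ := stdGaussian (EuclideanSpace ℝ (Fin d))
  have hp : ∀ c : ℝ, IsProbabilityMeasure (γ.map (c • ·)) :=
    fun c ↦ Measure.isProbabilityMeasure_map (by fun_prop)
  have hconv : (γ.map (a • ·)) ∗ (γ.map (b • ·)) = γ.map (√(a ^ 2 + b ^ 2) • ·) := by
    refine Measure.ext_of_charFun ?_
    ext t
    rw [charFun_conv, charFun_map_smul, charFun_map_smul, charFun_map_smul, charFun_stdGaussian,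
      charFun_stdGaussian, charFun_stdGaussian, ← Complex.exp_add]
    congr 1
    simp only [norm_smul, norm_eq_abs]
    norm_cast
    simp only [mul_pow, sq_abs, sq_sqrt (add_nonneg (sq_nonneg a) (sq_nonneg b))]
    ring
  have h := Measure.lintegral_conv (μ := γ.map (a • ·)) (ν := γ.map (b • ·)) hf
  rw [hconv, lintegral_map hf (by fun_prop), lintegral_map (by fun_prop) (by fun_prop)] at h
  rw [h]
  refine lintegral_congr fun g ↦ ?_
  rw [lintegral_map (by fun_prop) (by fun_prop)]

end Gaussian

section Comparison

open ProbabilityTheory Filter Topology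

variable {d : ℕ} {μ : Measure (EuclideanSpace ℝ (Fin d))} {ε k : ℝ}

lemma IsUniformOnSphere.smoothedMean_abs (hμ : IsUniformOnSphere μ)
    (y : EuclideanSpace ℝ (Fin d)) (r : ℝ) :
    smoothedMean μ ε y k |r| = smoothedMean μ ε y k r := by
  rcases abs_choice r with h | h
  · rw [h]
  · rw [h, smoothedMean, smoothedMean, ← hμ.integral_comp (LinearIsometryEquiv.neg ℝ)]
    simp

variable [IsProbabilityMeasure μ]

lemma smoothed_rpow_le (hε : 0 < ε) (hk : 0 ≤ k) (z : EuclideanSpace ℝ (Fin d)) :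
    (ε + ‖z‖ ^ 2) ^ (-k) ≤ ε ^ (-k) :=
  rpow_le_rpow_of_nonpos hε (by nlinarith [sq_nonneg ‖z‖]) (by linarith)

lemma smoothedMean_le (hε : 0 < ε) (hk : 0 ≤ k) (y : EuclideanSpace ℝ (Fin d)) (r : ℝ) :
    smoothedMean μ ε y k r ≤ ε ^ (-k) := by
  refine (integral_mono_of_nonneg (.of_forall fun x ↦ by positivity) (integrable_const (ε ^ (-k)))
    (.of_forall fun x ↦ smoothed_rpow_le hε hk _)).trans ?_
  simp

lemma IsUniformOnSphere.continuous_smoothedMean (hμ : IsUniformOnSphere μ) (hε : 0 < ε)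
    (y : EuclideanSpace ℝ (Fin d)) : Continuous (smoothedMean μ ε y k) :=
  continuous_iff_continuousAt.2 fun r ↦ (hμ.hasDerivAt_smoothedMean hε y k r).continuousAt

lemma IsUniformOnSphere.integrable_smoothedMean (hμ : IsUniformOnSphere μ) (hε : 0 < ε)
    (hk : 0 ≤ k) (y : EuclideanSpace ℝ (Fin d)) (a : ℝ) :
    Integrable (fun g ↦ smoothedMean μ ε y k (a * ‖g‖))
      (stdGaussian (EuclideanSpace ℝ (Fin d))) := by
  have := hμ.continuous_smoothedMean (k := k) hε y
  refine Integrable.of_bound (C := ε ^ (-k)) (Continuous.aestronglyMeasurable (by fun_prop))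
    (.of_forall fun g ↦ ?_)
  rw [norm_of_nonneg (smoothedMean_nonneg hε _ _ _)]
  exact smoothedMean_le hε hk y _

/-- Jensen's inequality in the squared radius. -/
lemma IsUniformOnSphere.smoothedMean_le_integral_stdGaussian (hμ : IsUniformOnSphere μ)
    (hε : 0 < ε) (hd : 2 ≤ d) (y : EuclideanSpace ℝ (Fin d)) (hk : 0 < k)
    (hkd : 2 * k ≤ d - 4) (a : ℝ) :
    smoothedMean μ ε y k a ≤
      ∫ g, smoothedMean μ ε y k (a / √d * ‖g‖) ∂stdGaussian (EuclideanSpace ℝ (Fin d)) := by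
  rcases eq_or_ne a 0 with rfl | ha
  · simp
  have hd0 : (0 : ℝ) < d := by positivity
  obtain ⟨c, hc⟩ := hμ.exists_supporting_sq_smoothedMean hε hd y hk hkd (abs_pos.2 ha)
  have hlin : ∫ g, (smoothedMean μ ε y k |a| + c * ((a ^ 2 / d) * ‖g‖ ^ 2 - a ^ 2))
      ∂stdGaussian (EuclideanSpace ℝ (Fin d)) = smoothedMean μ ε y k a := by
    have hi := (integrable_norm_sq_stdGaussian (d := d)).const_mul (a ^ 2 / d)
    have hi' : Integrable (fun g ↦ c * ((a ^ 2 / d) * ‖g‖ ^ 2 - a ^ 2))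
        (stdGaussian (EuclideanSpace ℝ (Fin d))) := (hi.sub (integrable_const _)).const_mul c
    rw [integral_add (integrable_const _) hi', integral_const_mul,
      integral_sub hi (integrable_const _), integral_const_mul,
      integral_norm_sq_stdGaussian (by omega), hμ.smoothedMean_abs]
    simp [hd0.ne']
  rw [← hlin]
  refine integral_mono ?_ (hμ.integrable_smoothedMean hε hk.le y _) fun g ↦ ?_
  · exact (integrable_const _).add
      (((integrable_norm_sq_stdGaussian.const_mul _).sub (integrable_const _)).const_mul c)
  · have h := hc |a / √d * ‖g‖| (abs_nonneg _)
    rwa [hμ.smoothedMean_abs y (a / √d * ‖g‖), sq_abs, sq_abs, mul_pow, div_pow,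
      sq_sqrt hd0.le] at h

lemma ofReal_smoothed_rpow_le (hε : 0 ≤ ε) (hk : 0 ≤ k) (z : EuclideanSpace ℝ (Fin d)) :
    ENNReal.ofReal ((ε + ‖z‖ ^ 2) ^ (-k)) ≤ (‖z‖₊ : ℝ≥0∞) ^ (-(2 * k)) := by
  rcases eq_or_ne z 0 with rfl | hz
  · rcases hk.eq_or_lt with rfl | hk
    · simp
    · simp [ENNReal.zero_rpow_of_neg, hk]
  have hz' : 0 < ‖z‖ := norm_pos_iff.2 hz
  rw [← enorm_eq_nnnorm, ← ofReal_norm, ENNReal.ofReal_rpow_of_pos hz']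
  refine ENNReal.ofReal_le_ofReal ?_
  rw [show -(2 * k) = 2 * -k by ring, rpow_mul hz'.le, rpow_two]
  exact rpow_le_rpow_of_nonpos (by positivity) (by linarith) (by linarith)

lemma tendsto_ofReal_smoothed_rpow (z : EuclideanSpace ℝ (Fin d)) :
    Tendsto (fun n : ℕ ↦ ENNReal.ofReal ((1 / ((n : ℝ) + 1) + ‖z‖ ^ 2) ^ (-k))) atTop
      (𝓝 ((‖z‖₊ : ℝ≥0∞) ^ (-(2 * k)))) := by
  have h0 : Tendsto (fun n : ℕ ↦ 1 / ((n : ℝ) + 1) + ‖z‖ ^ 2) atTop (𝓝 (0 + ‖z‖ ^ 2)) :=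
    tendsto_one_div_add_atTop_nhds_zero_nat.add_const _
  have h1 : ∀ n : ℕ, ENNReal.ofReal ((1 / ((n : ℝ) + 1) + ‖z‖ ^ 2) ^ (-k)) =
      ENNReal.ofReal (1 / ((n : ℝ) + 1) + ‖z‖ ^ 2) ^ (-k) := fun n ↦ by
    rw [ENNReal.ofReal_rpow_of_pos (by positivity)]
  have h2 : (‖z‖₊ : ℝ≥0∞) ^ (-(2 * k)) = ENNReal.ofReal (0 + ‖z‖ ^ 2) ^ (-k) := by
    rw [zero_add, ENNReal.ofReal_pow (norm_nonneg _), ofReal_norm, enorm_eq_nnnorm,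
      ← ENNReal.rpow_two, ← ENNReal.rpow_mul]
    ring_nf
  simp only [h1, h2]
  exact (ENNReal.continuous_rpow_const.tendsto _).comp (ENNReal.tendsto_ofReal h0)

/-- A summand uniform on the sphere may be replaced by a Gaussian one. -/
lemma IsUniformOnSphere.lintegral_le_lintegral_stdGaussian (hμ : IsUniformOnSphere μ)
    (hd : 2 ≤ d) (hk : 0 < k) (hkd : 2 * k ≤ d - 4) (a : ℝ) (y : EuclideanSpace ℝ (Fin d)) :
    ∫⁻ x, (‖y + a • x‖₊ : ℝ≥0∞) ^ (-(2 * k)) ∂μ ≤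
      ∫⁻ g, (‖y + (a / √d) • g‖₊ : ℝ≥0∞) ^ (-(2 * k))
        ∂stdGaussian (EuclideanSpace ℝ (Fin d)) := by
  have hle : ∀ ε : ℝ, 0 < ε → ∫⁻ x, ENNReal.ofReal ((ε + ‖y + a • x‖ ^ 2) ^ (-k)) ∂μ ≤
      ∫⁻ g, (‖y + (a / √d) • g‖₊ : ℝ≥0∞) ^ (-(2 * k))
        ∂stdGaussian (EuclideanSpace ℝ (Fin d)) := by
    intro ε hε
    have hof : ∀ r : ℝ, ENNReal.ofReal (smoothedMean μ ε y k r) =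
        ∫⁻ x, ENNReal.ofReal ((ε + ‖y + r • x‖ ^ 2) ^ (-k)) ∂μ := fun r ↦
      ofReal_integral_eq_lintegral_ofReal (hμ.integrable (continuous_smoothed_rpow hε y _ r))
        (.of_forall fun x ↦ by positivity)
    calc ∫⁻ x, ENNReal.ofReal ((ε + ‖y + a • x‖ ^ 2) ^ (-k)) ∂μ
        = ENNReal.ofReal (smoothedMean μ ε y k a) := (hof a).symm
      _ ≤ ENNReal.ofReal (∫ g, smoothedMean μ ε y k (a / √d * ‖g‖)
            ∂stdGaussian (EuclideanSpace ℝ (Fin d))) :=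
          ENNReal.ofReal_le_ofReal
            (hμ.smoothedMean_le_integral_stdGaussian hε hd y hk hkd a)
      _ = ∫⁻ g, ∫⁻ x, ENNReal.ofReal ((ε + ‖y + (a / √d) • (‖g‖ • x)‖ ^ 2) ^ (-k)) ∂μ
            ∂stdGaussian (EuclideanSpace ℝ (Fin d)) := by
          rw [ofReal_integral_eq_lintegral_ofReal (hμ.integrable_smoothedMean hε hk.le y _)
            (.of_forall fun g ↦ smoothedMean_nonneg hε _ _ _)]
          simp only [hof, mul_smul]
      _ = ∫⁻ g, ENNReal.ofReal ((ε + ‖y + (a / √d) • g‖ ^ 2) ^ (-k))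
            ∂stdGaussian (EuclideanSpace ℝ (Fin d)) := by
          conv_rhs => rw [← hμ.map_norm_smul_stdGaussian]
          rw [lintegral_map (by fun_prop) (by fun_prop), lintegral_prod _ (by fun_prop)]
      _ ≤ _ := lintegral_mono fun g ↦ ofReal_smoothed_rpow_le hε.le hk.le _
  calc ∫⁻ x, (‖y + a • x‖₊ : ℝ≥0∞) ^ (-(2 * k)) ∂μ
      = ∫⁻ x, liminf (fun n : ℕ ↦
          ENNReal.ofReal ((1 / ((n : ℝ) + 1) + ‖y + a • x‖ ^ 2) ^ (-k))) atTop ∂μ :=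
        lintegral_congr fun x ↦ (tendsto_ofReal_smoothed_rpow _).liminf_eq.symm
    _ ≤ liminf (fun n : ℕ ↦
          ∫⁻ x, ENNReal.ofReal ((1 / ((n : ℝ) + 1) + ‖y + a • x‖ ^ 2) ^ (-k)) ∂μ) atTop :=
        lintegral_liminf_le fun n ↦ by fun_prop
    _ ≤ _ := liminf_le_of_frequently_le'
        (Frequently.of_forall fun n ↦ hle _ (by positivity))

lemma IsUniformOnSphere.lintegral_sum_le_lintegral_stdGaussian (hμ : IsUniformOnSphere μ)
    (hd : 2 ≤ d) (hk : 0 < k) (hkd : 2 * k ≤ d - 4) {n : ℕ} (a : Fin n → ℝ)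
    (y : EuclideanSpace ℝ (Fin d)) :
    ∫⁻ x, (‖y + ∑ i, a i • x i‖₊ : ℝ≥0∞) ^ (-(2 * k)) ∂(Measure.pi fun _ : Fin n => μ) ≤
      ∫⁻ g, (‖y + (√(∑ i, a i ^ 2) / √d) • g‖₊ : ℝ≥0∞) ^ (-(2 * k))
        ∂stdGaussian (EuclideanSpace ℝ (Fin d)) := by
  induction n generalizing y with
  | zero => simp
  | succ n ih =>
    set γ := stdGaussian (EuclideanSpace ℝ (Fin d))
    set s := ∑ i : Fin n, a i.succ ^ 2
    have hs : 0 ≤ s := Finset.sum_nonneg fun i _ ↦ sq_nonneg _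
    have hpi := (measurePreserving_piFinSuccAbove (fun _ : Fin (n + 1) ↦ μ) 0).symm
    calc ∫⁻ x, (‖y + ∑ i, a i • x i‖₊ : ℝ≥0∞) ^ (-(2 * k))
          ∂(Measure.pi fun _ : Fin (n + 1) => μ)
        = ∫⁻ x₀, ∫⁻ x, (‖(y + a 0 • x₀) + ∑ i : Fin n, a i.succ • x i‖₊ : ℝ≥0∞) ^ (-(2 * k))
            ∂(Measure.pi fun _ : Fin n => μ) ∂μ := by
          rw [← hpi.lintegral_comp (by fun_prop), lintegral_prod _ (by fun_prop)]
          simp [Fin.sum_univ_succ, MeasurableEquiv.piFinSuccAbove, add_assoc]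
      _ ≤ ∫⁻ x₀, ∫⁻ g, (‖(y + a 0 • x₀) + (√s / √d) • g‖₊ : ℝ≥0∞) ^ (-(2 * k)) ∂γ ∂μ :=
          lintegral_mono fun x₀ ↦ ih _ _
      _ = ∫⁻ g, ∫⁻ x₀, (‖(y + (√s / √d) • g) + a 0 • x₀‖₊ : ℝ≥0∞) ^ (-(2 * k)) ∂μ ∂γ := by
          rw [lintegral_lintegral_swap (by fun_prop)]
          simp only [add_right_comm]
      _ ≤ ∫⁻ g, ∫⁻ h, (‖(y + (√s / √d) • g) + (a 0 / √d) • h‖₊ : ℝ≥0∞) ^ (-(2 * k)) ∂γ ∂γ :=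
          lintegral_mono fun g ↦ hμ.lintegral_le_lintegral_stdGaussian hd hk hkd _ _
      _ = _ := by
          simp only [add_assoc]
          rw [lintegral_lintegral_add_smul_stdGaussian (√s / √d) (a 0 / √d)
            (f := fun z ↦ (‖y + z‖₊ : ℝ≥0∞) ^ (-(2 * k))) (by fun_prop), Fin.sum_univ_succ,
            div_pow, div_pow, ← add_div, sqrt_div (by positivity), sqrt_sq (by positivity),
            sq_sqrt hs, add_comm s]

lemma lintegral_nnnorm_smul_rpow_stdGaussian (hd : 0 < d) {q c : ℝ} (hq : -d < q) (hc : 0 < c) :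
    ∫⁻ g, (‖c • g‖₊ : ℝ≥0∞) ^ q ∂stdGaussian (EuclideanSpace ℝ (Fin d)) =
      ENNReal.ofReal (c ^ q * (2 ^ (q / 2) * (Gamma ((d + q) / 2) / Gamma (d / 2)))) := by
  have : Nonempty (Fin d) := ⟨⟨0, hd⟩⟩
  rw [ENNReal.ofReal_mul (by positivity), ← lintegral_norm_rpow_stdGaussian hd hq,
    ← lintegral_const_mul _ (by fun_prop)]
  have hne : ∀ᵐ g ∂stdGaussian (EuclideanSpace ℝ (Fin d)), g ≠ 0 := by
    rw [stdGaussian_eq_withDensity]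
    exact (withDensity_absolutelyContinuous _ _).ae_le (Measure.ae_ne volume 0)
  refine lintegral_congr_ae ?_
  filter_upwards [hne] with g hg
  have hg' : 0 < ‖g‖ := norm_pos_iff.2 hg
  rw [← enorm_eq_nnnorm, ← ofReal_norm, norm_smul, norm_of_nonneg hc.le,
    ENNReal.ofReal_rpow_of_pos (by positivity), mul_rpow hc.le hg'.le,
    ENNReal.ofReal_mul (by positivity)]

end Comparison

/-- For `d ≥ 5` and `0 < p ≤ d - 4`, the sum `S = ∑ aₖ ξₖ` of independent random
vectors uniform on `S^{d-1}` satisfies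
`E|S|^{-p} ≤ (d/2)^{p/2} (Γ((d-p)/2)/Γ(d/2)) (∑ aₖ²)^{-p/2}`. -/
theorem negative_moment_bound_high_dim
    (d : ℕ) (hd : 5 ≤ d) (p : ℝ) (hp : 0 < p) (hpd : p ≤ (d : ℝ) - 4)
    (μ : Measure (EuclideanSpace ℝ (Fin d))) [IsProbabilityMeasure μ]
    (hμ : IsUniformOnSphere μ)
    (n : ℕ) (hn : 1 ≤ n) (a : Fin n → ℝ) (ha : a ≠ 0) :
    ∫⁻ x, (‖∑ k, a k • x k‖₊ : ℝ≥0∞) ^ (-p) ∂(Measure.pi fun _ : Fin n => μ)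
      ≤ ENNReal.ofReal (((d : ℝ) / 2) ^ (p / 2) *
          (Real.Gamma (((d : ℝ) - p) / 2) / Real.Gamma ((d : ℝ) / 2)) *
          (∑ k, (a k) ^ 2) ^ (-p / 2)) := by
  have hd0 : (0 : ℝ) < d := by positivity
  have hs : 0 < ∑ k, a k ^ 2 := by
    obtain ⟨i, hi⟩ := Function.ne_iff.1 ha
    exact Finset.sum_pos' (fun _ _ ↦ sq_nonneg _) ⟨i, Finset.mem_univ i, sq_pos_of_ne_zero hi⟩
  have h := hμ.lintegral_sum_le_lintegral_stdGaussian (k := p / 2) (by omega) (by positivity)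
    (by linarith) a 0
  simp only [zero_add, mul_div_cancel₀ p (two_ne_zero (α := ℝ))] at h
  refine h.trans_eq ?_
  rw [lintegral_nnnorm_smul_rpow_stdGaussian (by omega) (by linarith) (by positivity)]
  congr 1
  generalize ∑ k, a k ^ 2 = s at hs
  rw [← sqrt_div hs.le, sqrt_eq_rpow, ← rpow_mul (by positivity), div_rpow hs.le hd0.le,
    div_rpow hd0.le two_pos.le, show 1 / 2 * -p = -p / 2 by ring, ← sub_eq_add_neg,
    neg_div, rpow_neg hd0.le, rpow_neg two_pos.le, div_inv_eq_mul, rpow_neg hs.le]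
  ring
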